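/- arXiv:1804.09704 — 5 statements merged into one kernel-verified Lean document; each statement's English description precedes it below -/
import Mathlib

section
/- Let K be an algebraically closed field of characteristic 0, let m, n be positive integers, and let ω ∈ K be a primitive m-th root of unity. Let A be the mn-by-mn matrix over K partitioned into n² blocks A(i,j), 1 ≤ i,j ≤ n, where each block A(i,j) = circ(a_0(i,j), …, a_{m−1}(i,j)) is an m-by-m circulant matrix. For k = 0, …, m−1 let S_k be the n-by-n matrix over K whose (i,j) entry is s_k(i,j) = Σ_{ℓ=0}^{m−1} a_ℓ(i,j) ω^{kℓ}. Then the characteristic polynomial of A equals the product over k = 0, …, m−1 of the characteristic polynomials of the matrices S_k; equivalently, the spectrum of A counted with multiplicity is the multiset union ⋃_{k=0}^{m−1} σ(S_k). -/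
open Matrix Polynomial BigOperators

namespace Matrix

theorem charmatrix_blockDiagonal {R n o : Type*} [CommRing R] [Fintype n] [DecidableEq n]
    [Fintype o] [DecidableEq o] (M : o → Matrix n n R) :
    (blockDiagonal M).charmatrix = blockDiagonal fun k => (M k).charmatrix := by
  ext1 ⟨i, p⟩ ⟨j, q⟩
  by_cases hpq : p = q
  · subst hpq
    by_cases hij : i = j <;> simp [blockDiagonal_apply, hij]
  · simp [blockDiagonal_apply, hpq]

theorem charpoly_blockDiagonal {R n o : Type*} [CommRing R] [Fintype n] [DecidableEq n]
    [Fintype o] [DecidableEq o] (M : o → Matrix n n R) :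
    (blockDiagonal M).charpoly = ∏ k, (M k).charpoly := by
  simp only [charpoly, charmatrix_blockDiagonal, det_blockDiagonal]

theorem charpoly_eq_of_mul_eq_mul {R n : Type*} [CommRing R] [Fintype n] [DecidableEq n]
    {A B P : Matrix n n R} (hP : IsUnit P.det) (h : A * P = P * B) :
    A.charpoly = B.charpoly := by
  obtain ⟨U, rfl⟩ := (isUnit_iff_isUnit_det P).mpr hP
  rw [← charpoly_units_conj U B, ← h, ← coe_units_inv, Units.mul_inv_cancel_right]

end Matrix

theorem IsPrimitiveRoot.det_vandermonde_pow_ne_zero {R : Type*} [CommRing R] [IsDomain R]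
    {m : ℕ} {ω : R} (hω : IsPrimitiveRoot ω m) :
    (vandermonde fun p : Fin m => ω ^ (p : ℕ)).det ≠ 0 :=
  det_vandermonde_ne_zero_iff.mpr fun p q h => Fin.ext (hω.pow_inj p.2 q.2 h)

/-- For an `mn × mn` matrix over an algebraically closed field `K` of
characteristic zero, partitioned into `n²` circulant `m × m` blocks
`A(i,j) = circ(a_0(i,j), …, a_{m-1}(i,j))`, and with `ω` a primitive `m`-th root of
unity, the characteristic polynomial of `A` is the product of the characteristic
polynomials of the matrices `S_k`, where `S_k (i,j) = Σ_ℓ a_ℓ(i,j) ω^{kℓ}`. -/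
theorem block_circulant_charpoly_eq_prod
    {K : Type*} [Field K] [IsAlgClosed K] [CharZero K]
    (m n : ℕ) (hm : 0 < m) (hn : 0 < n)
    (ω : K) (hω : IsPrimitiveRoot ω m)
    (a : Fin m → Fin n → Fin n → K)
    (A : Matrix (Fin n × Fin m) (Fin n × Fin m) K)
    (hA : ∀ (i j : Fin n) (p q : Fin m), A (i, p) (j, q) = a (q - p) i j)
    (S : Fin m → Matrix (Fin n) (Fin n) K)
    (hS : ∀ (k : Fin m) (i j : Fin n),
      S k i j = ∑ ℓ : Fin m, a ℓ i j * ω ^ ((k : ℕ) * (ℓ : ℕ))) :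
    A.charpoly = ∏ k : Fin m, (S k).charpoly := by
  have : NeZero m := ⟨hm.ne'⟩
  have hP : IsUnit (kroneckerMap (· * ·) (1 : Matrix (Fin n) (Fin n) K)
      (vandermonde fun p : Fin m => ω ^ (p : ℕ))).det := by
    rw [det_kronecker, det_one, one_pow, one_mul]
    exact (hω.det_vandermonde_pow_ne_zero.isUnit).pow _
  rw [charpoly_eq_of_mul_eq_mul (B := blockDiagonal S) hP, charpoly_blockDiagonal]
  ext ⟨i, p⟩ ⟨j, k⟩
  have hpow (ℓ : Fin m) : (ω ^ ((p + ℓ : Fin m) : ℕ)) = ω ^ (p : ℕ) * ω ^ (ℓ : ℕ) := by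
    rw [Fin.val_add, ← pow_add]
    exact (pow_eq_pow_mod _ hω.pow_eq_one).symm
  simp only [mul_apply, Fintype.sum_prod_type, hA, kronecker_apply, one_apply, vandermonde_apply,
    blockDiagonal_apply, ite_mul, mul_ite, one_mul, zero_mul, mul_zero, Finset.sum_ite_eq',
    Finset.sum_ite_eq, Finset.sum_ite_irrel, Finset.sum_const_zero, Finset.mem_univ, if_true]
  rw [hS, Finset.mul_sum, ← Equiv.sum_comp (Equiv.addLeft p)]
  refine Finset.sum_congr rfl fun ℓ _ => ?_
  rw [Equiv.coe_addLeft, hpow, add_sub_cancel_left, mul_pow, ← pow_mul ω (ℓ : ℕ),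
    mul_comm (ℓ : ℕ)]
  ring
end

section
/- Let m, n be positive integers and let S′_0, S′_1, …, S′_{m−1} be arbitrary n-by-n complex matrices. Then there exists an mn-by-mn complex matrix A′ partitioned into n² blocks A′(i,j), 1 ≤ i,j ≤ n, each block being an m-by-m circulant matrix, such that the characteristic polynomial of A′ equals the product over ℓ = 0, …, m−1 of the characteristic polynomials of the S′_ℓ; equivalently, the spectrum of A′ counted with multiplicity is the multiset union ⋃_{ℓ=0}^{m−1} σ(S′_ℓ). -/
open Matrix Polynomial BigOperators

namespace Matrix

/-- The Fourier matrix of `ZMod N`. -/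
noncomputable def fourier (N : ℕ) [NeZero N] : Matrix (ZMod N) (ZMod N) ℂ :=
  of fun p q => ZMod.stdAddChar (p * q)

/-- The inverse of the Fourier matrix of `ZMod N`. -/
noncomputable def fourierInv (N : ℕ) [NeZero N] : Matrix (ZMod N) (ZMod N) ℂ :=
  of fun p q => (N : ℂ)⁻¹ * ZMod.stdAddChar (-(p * q))

theorem fourierInv_mul_fourier (N : ℕ) [NeZero N] : fourierInv N * fourier N = 1 := by
  ext p q
  have h := AddChar.sum_mulShift (q - p) (ZMod.isPrimitive_stdAddChar N)
  have hN : (N : ℂ) ≠ 0 := NeZero.ne _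
  calc (fourierInv N * fourier N) p q
      = (N : ℂ)⁻¹ * ∑ x : ZMod N, ZMod.stdAddChar (x * (q - p)) := by
        rw [mul_apply, Finset.mul_sum]
        refine Finset.sum_congr rfl fun x _ => ?_
        rw [fourierInv, fourier, of_apply, of_apply, mul_assoc, ← AddChar.map_add_eq_mul]
        congr 2
        ring
    _ = (1 : Matrix (ZMod N) (ZMod N) ℂ) p q := by
        rw [h, one_apply]
        by_cases hpq : p = q
        · simp [hpq, hN]
        · simp [hpq, sub_eq_zero, Ne.symm hpq]

theorem exists_circulant_blocks_charpoly_eq_prod {N : ℕ} [NeZero N] {n : Type*} [Fintype n]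
    [DecidableEq n] (S : ZMod N → Matrix n n ℂ) :
    ∃ A : Matrix (n × ZMod N) (n × ZMod N) ℂ,
      (∃ a : ZMod N → n → n → ℂ, ∀ i j p q, A (i, p) (j, q) = a (q - p) i j) ∧
      A.charpoly = ∏ k, (S k).charpoly := by
  refine ⟨kroneckerMap (· * ·) 1 (fourier N) *
    (blockDiagonal S * kroneckerMap (· * ·) 1 (fourierInv N)),
    ⟨fun r i j => ∑ k, (N : ℂ)⁻¹ * ZMod.stdAddChar (-(r * k)) * S k i j, ?_⟩, ?_⟩
  · intro i j p q
    simp only [mul_apply, Fintype.sum_prod_type, kroneckerMap_apply, one_apply,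
      blockDiagonal_apply, ite_mul, mul_ite, one_mul, zero_mul, mul_zero, Finset.sum_ite_eq,
      Finset.sum_ite_eq', Finset.mem_univ, if_true, Finset.sum_ite_irrel, Finset.sum_const_zero]
    refine Finset.sum_congr rfl fun k _ => ?_
    have h : ZMod.stdAddChar (-((q - p) * k)) =
        ZMod.stdAddChar (p * k) * ZMod.stdAddChar (-(k * q)) := by
      rw [← AddChar.map_add_eq_mul]
      congr 1
      ring
    simp only [fourier, fourierInv, of_apply, h]
    ring
  · rw [charpoly_mul_comm, Matrix.mul_assoc, ← mul_kronecker_mul, fourierInv_mul_fourier,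
      Matrix.one_mul, one_kronecker_one, Matrix.mul_one, charpoly_blockDiagonal]

end Matrix

/-- Given arbitrary `n × n` complex matrices `S′_0, …, S′_{m-1}`, there
exists an `mn × mn` complex matrix `A′` partitioned into `n²` circulant `m × m`
blocks whose characteristic polynomial is the product of the characteristic
polynomials of the `S′_ℓ`. -/
theorem exists_block_circulant_with_given_spectra
    (m n : ℕ) (hm : 0 < m) (hn : 0 < n)
    (S' : Fin m → Matrix (Fin n) (Fin n) ℂ) :
    ∃ A' : Matrix (Fin n × Fin m) (Fin n × Fin m) ℂ,
      (∃ a : Fin m → Fin n → Fin n → ℂ,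
        ∀ (i j : Fin n) (p q : Fin m), A' (i, p) (j, q) = a (q - p) i j) ∧
      A'.charpoly = ∏ ℓ : Fin m, (S' ℓ).charpoly := by
  obtain ⟨k, rfl⟩ : ∃ k, m = k + 1 := ⟨m - 1, by omega⟩
  exact Matrix.exists_circulant_blocks_charpoly_eq_prod (N := k + 1) S'
end

section
/- Let n ≥ 3 be an odd integer, let a > 0, b > 0 be real numbers, and let λ₁ be a real number with λ₁ ≥ √(a² + b²). Let σ be the list of n complex numbers consisting of λ₁ together with (n−1)/2 copies of −a + bi and (n−1)/2 copies of −a − bi. Then σ is realizable by an n-by-n nonnegative matrix if and only if λ₁ ≥ (n−1)a + n·max{0, b/√n − a}. -/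
open Matrix Polynomial Complex

/-- The characteristic polynomial of `A * A` has the squares of the eigenvalues of `A` as roots. -/
theorem charpoly_mul_self {ι K : Type*} [Fintype ι] [DecidableEq ι] [Field K] [IsAlgClosed K]
    (A : Matrix ι ι K) :
    (A * A).charpoly = (A.charpoly.roots.map fun r => X - C (r ^ 2)).prod := by
  have : Infinite K := IsAlgClosed.instInfinite
  have hA : ∀ x, (scalar ι x - A).det = (A.charpoly.roots.map fun r => x - r).prod := fun x => by
    rw [← eval_charpoly]
    exact (IsAlgClosed.splits A.charpoly).eval_eq_prod_roots_of_monic A.charpoly_monic x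
  have hcard : A.charpoly.roots.card = Fintype.card ι := by
    rw [← (IsAlgClosed.splits A.charpoly).natDegree_eq_card_roots, charpoly_natDegree_eq_dim]
  refine Polynomial.funext fun y => ?_
  obtain ⟨x, rfl⟩ := IsAlgClosed.exists_pow_nat_eq y (n := 2) (by norm_num)
  have hfac : scalar ι (x ^ 2) - A * A = (scalar ι x - A) * -(scalar ι (-x) - A) := by
    have hc : scalar ι x * A = A * scalar ι x := (scalar_commute x (Commute.all x) A).eq
    rw [map_neg, pow_two, map_mul, neg_sub, sub_neg_eq_add, sub_mul, mul_add, mul_add, hc]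
    abel
  rw [eval_charpoly, hfac, det_mul, det_neg, hA, hA, eval_multiset_prod, Multiset.map_map, ← hcard,
    ← Multiset.card_map (fun r => -x - r), ← Multiset.prod_map_neg, Multiset.map_map, ← Multiset.prod_map_mul]
  congr 1
  refine Multiset.map_congr rfl fun r _ => ?_
  simp
  ring

/-- The trace of `A * A` is the sum of the squares of the eigenvalues of `A`. -/
theorem trace_mul_self_eq_sum_roots {ι K : Type*} [Fintype ι] [DecidableEq ι] [Field K]
    [IsAlgClosed K] (A : Matrix ι ι K) :
    (A * A).trace = (A.charpoly.roots.map (· ^ 2)).sum := by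
  rw [trace_eq_sum_roots_charpoly, charpoly_mul_self]
  have h := roots_multiset_prod_X_sub_C (A.charpoly.roots.map (· ^ 2))
  rw [Multiset.map_map] at h
  exact congrArg Multiset.sum h

/-- The Johnson–Loewy–London inequality for the first two moments. -/
theorem sq_trace_le_card_mul_trace_mul_self {ι : Type*} [Fintype ι] {M : Matrix ι ι ℝ}
    (hM : ∀ i j, 0 ≤ M i j) : M.trace ^ 2 ≤ Fintype.card ι * (M * M).trace := by
  calc M.trace ^ 2 ≤ Fintype.card ι * ∑ i, M i i ^ 2 := sq_sum_le_card_mul_sum_sq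
    _ ≤ Fintype.card ι * (M * M).trace := by
      gcongr
      change _ ≤ ∑ i, (M * M) i i
      gcongr with i
      rw [mul_apply, pow_two]
      exact Finset.single_le_sum (f := fun j => M i j * M j i)
        (fun j _ => mul_nonneg (hM i j) (hM j i)) (Finset.mem_univ i)

/-- The companion matrix of a monic polynomial with nonpositive lower coefficients is
nonnegative. -/
theorem exists_nonneg_charpoly_eq {n : ℕ} {f : ℝ[X]} (hf : f.Monic) (hn : f.natDegree = n)
    (hcoeff : ∀ k < n, f.coeff k ≤ 0) :
    ∃ A : Matrix (Fin n) (Fin n) ℝ, (∀ i j, 0 ≤ A i j) ∧ A.charpoly = f := by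
  subst hn
  let pb := AdjoinRoot.powerBasis hf.ne_zero
  have hmin : minpoly ℝ pb.gen = f := AdjoinRoot.minpoly_powerBasis_gen_of_monic hf
  refine ⟨Algebra.leftMulMatrix pb.basis pb.gen, fun i j => ?_, ?_⟩
  · rw [pb.leftMulMatrix, pb.minpolyGen_eq, hmin]
    change 0 ≤ ite _ _ _
    split_ifs
    · exact neg_nonneg.2 (hcoeff _ i.2)
    · exact zero_le_one
    · exact le_rfl
  · exact (charpoly_leftMulMatrix pb).trans hmin

theorem coeff_X_mul_derivative {R : Type*} [CommSemiring R] (p : R[X]) (k : ℕ) :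
    (X * derivative p).coeff k = p.coeff k * k := by
  cases k <;> simp [coeff_derivative]

theorem coeff_pow_nonneg {p : ℝ[X]} (hp : ∀ k, 0 ≤ p.coeff k) (m k : ℕ) :
    0 ≤ (p ^ m).coeff k := by
  induction m generalizing k with
  | zero => rw [pow_zero, coeff_one]; split_ifs <;> norm_num
  | succ m ih =>
    rw [pow_succ, coeff_mul]
    exact Finset.sum_nonneg fun _ _ => mul_nonneg (ih _) (hp _)

/-- The factor `(x + a)² + b²` is nonnegative coefficientwise. -/
theorem coeff_quadratic_nonneg {a b : ℝ} (ha : 0 < a) (k : ℕ) :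
    0 ≤ ((X + C a) ^ 2 + C (b ^ 2) : ℝ[X]).coeff k := by
  have h : ((X + C a) ^ 2 + C (b ^ 2) : ℝ[X]) = X ^ 2 + C (2 * a) * X + C (a ^ 2 + b ^ 2) := by
    simp only [map_add, map_mul, map_pow, map_ofNat]; ring
  rw [h, coeff_add, coeff_add, coeff_X_pow, coeff_C_mul, coeff_X, coeff_C]
  split_ifs <;> simp <;> positivity

/-- Ratio bound on consecutive coefficients of `((x + a)² + b²)ᵐ`. -/
theorem coeff_quadratic_pow_le {a b : ℝ} (ha : 0 < a) {m : ℕ}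
    (hab : b ^ 2 ≤ (2 * m + 1) * a ^ 2) {k : ℕ} (hk : k + 1 ≤ 2 * m) :
    (((X + C a) ^ 2 + C (b ^ 2) : ℝ[X]) ^ m).coeff k ≤
      2 * m * a * (((X + C a) ^ 2 + C (b ^ 2) : ℝ[X]) ^ m).coeff (k + 1) := by
  obtain ⟨m, rfl⟩ := Nat.exists_eq_add_of_le' (show 1 ≤ m by lia)
  set q : ℝ[X] := (X + C a) ^ 2 + C (b ^ 2) with hq
  have hq0 : ∀ k, 0 ≤ q.coeff k := coeff_quadratic_nonneg ha
  set g : ℝ[X] := q ^ (m + 1) with hg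
  have hdq : derivative q = C 2 * (X + C a) := by
    rw [hq]; simp [derivative_pow]
  have hd : derivative g = C (2 * (m + 1) : ℝ) * (X + C a) * q ^ m := by
    rw [hg, derivative_pow, hdq]; simp; ring
  have h1 : C (2 * (m + 1) : ℝ) * g - X * derivative g - C a * derivative g =
      C (2 * (m + 1) * b ^ 2) * q ^ m := by
    rw [hd, hg, pow_succ, C_mul (b := b ^ 2)]
    linear_combination C (2 * (m + 1) : ℝ) * q ^ m * hq
  have h2 : X * (X * derivative g) + C (2 * a) * (X * derivative g) +
      C (a ^ 2 + b ^ 2) * derivative g = C (2 * (m + 1) : ℝ) * (X * g) + C (2 * (m + 1) * a) * g := by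
    have h : X * (X * derivative g) + C (2 * a) * (X * derivative g) +
      C (a ^ 2 + b ^ 2) * derivative g = q * derivative g := by
      rw [hq]; simp only [map_add, map_mul, map_pow, map_ofNat]; ring
    rw [h, hd, hg, pow_succ, C_mul (b := a)]; ring
  have e1 := congrArg (coeff · (k + 1)) h1
  have e2 := congrArg (coeff · (k + 1)) h2
  simp only [coeff_add, coeff_sub, coeff_C_mul, coeff_X_mul, coeff_X_mul_derivative,
    coeff_derivative] at e1 e2
  have hpos := mul_nonneg (show 0 ≤ 2 * (m + 1) * b ^ 2 by positivity)
    (coeff_pow_nonneg hq0 m (k + 1))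
  rw [← e1] at hpos
  have hg2 : 0 ≤ g.coeff (k + 2) := coeff_pow_nonneg hq0 _ _
  have hkm : (k : ℝ) + 1 ≤ 2 * (m + 1) := by exact_mod_cast hk
  push_cast at *
  set u := g.coeff k
  set v := g.coeff (k + 1)
  set w := g.coeff (k + 1 + 1)
  have hc : (a ^ 2 + b ^ 2) * (w * (k + 1 + 1)) ≤
      (2 * (m + 1) + 2) * a * (a * (w * (k + 1 + 1))) := by
    nlinarith [mul_le_mul_of_nonneg_right hab (show 0 ≤ w * (k + 1 + 1) by positivity)]
  have hw := mul_le_mul_of_nonneg_left (sub_nonneg.1 hpos)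
    (show 0 ≤ (2 * ((m : ℝ) + 1) + 2) * a by positivity)
  refine le_of_mul_le_mul_left (a := 2 * ((m : ℝ) + 1) - k) ?_ (by linarith)
  linarith

theorem coeff_sub_mul_quadratic_pow_nonpos {a b : ℝ} (ha : 0 < a) {m : ℕ}
    (hab : b ^ 2 ≤ (2 * m + 1) * a ^ 2) {k : ℕ} (hk : k < 2 * m + 1) :
    ((X - C (2 * m * a)) * ((X + C a) ^ 2 + C (b ^ 2) : ℝ[X]) ^ m).coeff k ≤ 0 := by
  rw [sub_mul, coeff_sub, coeff_C_mul, sub_nonpos]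
  cases k with
  | zero =>
    rw [coeff_X_mul_zero]
    exact mul_nonneg (by positivity) (coeff_pow_nonneg (coeff_quadratic_nonneg ha) _ _)
  | succ k =>
    rw [coeff_X_mul]
    exact coeff_quadratic_pow_le ha hab (by lia)

theorem exists_nonneg_charpoly_eq_sub_mul_quadratic_pow {a b lam : ℝ} (ha : 0 < a) {m : ℕ}
    (h1 : 2 * m * a ≤ lam) (h2 : (2 * m + 1) * b ^ 2 ≤ (lam + a) ^ 2) :
    ∃ M : Matrix (Fin (2 * m + 1)) (Fin (2 * m + 1)) ℝ, (∀ i j, 0 ≤ M i j) ∧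
      M.charpoly = (X - C lam) * ((X + C a) ^ 2 + C (b ^ 2)) ^ m := by
  obtain ⟨t, ht⟩ : ∃ t : ℝ, (2 * m + 1) * t = lam - 2 * m * a :=
    ⟨(lam - 2 * m * a) / (2 * m + 1), by field_simp⟩
  have hm : (0 : ℝ) < 2 * m + 1 := by positivity
  have ht0 : 0 ≤ t := nonneg_of_mul_nonneg_right (by linarith) hm
  have hq : ((X + C (a + t)) ^ 2 + C (b ^ 2) : ℝ[X]).Monic ∧
      ((X + C (a + t)) ^ 2 + C (b ^ 2) : ℝ[X]).natDegree = 2 := by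
    have h : ((X + C (a + t)) ^ 2 : ℝ[X]).natDegree = 2 := by
      rw [natDegree_pow, natDegree_X_add_C]
    refine ⟨((monic_X_add_C _).pow 2).add_of_left ?_, ?_⟩
    · refine degree_C_le.trans_lt ?_
      rw [degree_eq_natDegree ((monic_X_add_C _).pow 2).ne_zero, h]; norm_num
    · rw [natDegree_add_C, h]
  obtain ⟨A, hA0, hA⟩ := exists_nonneg_charpoly_eq (n := 2 * m + 1)
    ((monic_X_sub_C (2 * m * (a + t))).mul (hq.1.pow m))
    (by rw [(monic_X_sub_C _).natDegree_mul (hq.1.pow m), natDegree_X_sub_C, hq.1.natDegree_pow,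
      hq.2]; ring)
    (fun k hk => coeff_sub_mul_quadratic_pow_nonpos (by positivity) (by
      have h : lam + a = (2 * m + 1) * (a + t) := by linarith
      rw [h] at h2
      refine le_of_mul_le_mul_left (h2.trans_eq ?_) hm
      ring) hk)
  refine ⟨A - scalar _ (-t), fun i j => ?_, ?_⟩
  · rw [map_neg, sub_neg_eq_add, Matrix.add_apply, scalar_apply, diagonal_apply]
    split_ifs
    · exact add_nonneg (hA0 i j) ht0
    · simpa using hA0 i j
  · rw [charpoly_sub_scalar, hA]
    have hlam : lam = 2 * m * (a + t) + t := by linarith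
    simp only [mul_comp, sub_comp, pow_comp, add_comp, X_comp, C_comp]
    rw [hlam]
    simp only [map_add, map_neg]
    ring

/-- The Guo-index bound amounts to nonnegativity of the trace together with the
Johnson–Loewy–London inequality. -/
theorem guo_bound_iff {n a b lam : ℝ} (hn : 0 < n) (hb : 0 ≤ b) (hlam : 0 ≤ lam + a) :
    (n - 1) * a + n * max 0 (b / √n - a) ≤ lam ↔
      (n - 1) * a ≤ lam ∧ n * b ^ 2 ≤ (lam + a) ^ 2 := by
  have hs : n * (b / √n) = √n * b := by
    rw [← mul_div_assoc, mul_comm n, mul_div_assoc, Real.div_sqrt, mul_comm]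
  have hsq : n * b ^ 2 = (√n * b) ^ 2 := by rw [mul_pow, Real.sq_sqrt hn.le]
  rw [mul_max_of_nonneg _ _ hn.le, ← max_add_add_left, max_le_iff, mul_sub, hs, hsq,
    sq_le_sq₀ (by positivity) hlam, mul_zero, add_zero]
  refine and_congr_right fun _ => ?_
  constructor <;> intro h <;> linarith

/-- For odd `n ≥ 3`, `a, b > 0` and `λ₁ ≥ √(a² + b²)`, the list consisting
of `λ₁` together with `(n-1)/2` copies of `-a + bi` and `(n-1)/2` copies of `-a - bi`
is realizable by an `n × n` nonnegative matrix iff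
`λ₁ ≥ (n-1)a + n·max{0, b/√n − a}`. -/
theorem guo_index_conjugate_pair_list
    (n : ℕ) (hn : 3 ≤ n) (hodd : Odd n)
    (a b : ℝ) (ha : 0 < a) (hb : 0 < b)
    (lam₁ : ℝ) (hlam : Real.sqrt (a ^ 2 + b ^ 2) ≤ lam₁) :
    (∃ M : Matrix (Fin n) (Fin n) ℝ,
      (∀ i j, 0 ≤ M i j) ∧
      (M.map Complex.ofReal).charpoly =
        (X - C (lam₁ : ℂ)) *
          ((X - C (-(a : ℂ) + (b : ℂ) * Complex.I)) *
            (X - C (-(a : ℂ) - (b : ℂ) * Complex.I))) ^ ((n - 1) / 2)) ↔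
    ((n : ℝ) - 1) * a + (n : ℝ) * max 0 (b / Real.sqrt n - a) ≤ lam₁ := by
  obtain ⟨m, rfl⟩ := hodd
  have hlam0 : 0 ≤ lam₁ + a := add_nonneg ((Real.sqrt_nonneg _).trans hlam) ha.le
  rw [guo_bound_iff (by positivity) hb.le hlam0, show (2 * m + 1 - 1) / 2 = m by lia]
  push_cast
  rw [add_sub_cancel_right]
  constructor
  · rintro ⟨M, hM, hchar⟩
    have hroots : (M.map Complex.ofReal).charpoly.roots =
        {(lam₁ : ℂ)} + m • ({-(a : ℂ) + b * I} + {-(a : ℂ) - b * I}) := by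
      have hz : ∀ z : ℂ, X - C z ≠ 0 := X_sub_C_ne_zero
      rw [hchar, roots_mul (mul_ne_zero (hz _) (pow_ne_zero _ (mul_ne_zero (hz _) (hz _)))),
        roots_pow, roots_mul (mul_ne_zero (hz _) (hz _))]
      simp only [roots_X_sub_C]
    have hmap : ∀ A : Matrix (Fin (2 * m + 1)) (Fin (2 * m + 1)) ℝ,
        (A.map Complex.ofReal).trace = (A.trace : ℂ) := fun A => (AddMonoidHom.map_trace ofRealHom A).symm
    have ht1 : M.trace = lam₁ - 2 * m * a := by
      have h := trace_eq_sum_roots_charpoly (M.map Complex.ofReal)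
      rw [hroots, hmap] at h
      apply Complex.ofReal_injective
      rw [h]
      simp [Multiset.sum_nsmul]
      ring
    have ht2 : (M * M).trace = lam₁ ^ 2 + 2 * m * (a ^ 2 - b ^ 2) := by
      have h := trace_mul_self_eq_sum_roots (M.map Complex.ofReal)
      have hmul : M.map Complex.ofReal * M.map Complex.ofReal = (M * M).map Complex.ofReal :=
        (Matrix.map_mul (f := ofRealHom)).symm
      rw [hroots, hmul, hmap] at h
      apply Complex.ofReal_injective
      rw [h]
      simp [Multiset.sum_nsmul, Multiset.map_nsmul]
      linear_combination (2 * m * b ^ 2 : ℂ) * I_sq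
    have h1 : 0 ≤ M.trace := Finset.sum_nonneg fun i _ => hM i i
    have h2 := sq_trace_le_card_mul_trace_mul_self hM
    rw [ht1] at h1 h2
    rw [ht2, Fintype.card_fin] at h2
    push_cast at h2
    have hm : (0 : ℝ) < 2 * m := by exact_mod_cast (show 0 < 2 * m by lia)
    refine ⟨by linarith, le_of_mul_le_mul_left ?_ hm⟩
    linarith
  · rintro ⟨h1, h2⟩
    obtain ⟨M, hM, hchar⟩ := exists_nonneg_charpoly_eq_sub_mul_quadratic_pow ha h1 h2
    refine ⟨M, hM, ?_⟩
    have hquad : (X - C (-(a : ℂ) + b * I)) * (X - C (-(a : ℂ) - b * I)) =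
        (X + C (a : ℂ)) ^ 2 + C ((b : ℂ) ^ 2) := by
      have hI : (C I : ℂ[X]) ^ 2 = -1 := by rw [← C_pow, I_sq, C_neg, C_1]
      simp only [map_add, map_sub, map_neg, map_mul, map_pow]
      linear_combination (-C (b : ℂ) ^ 2) * hI
    rw [hquad]
    have h := charpoly_map M ofRealHom
    rw [hchar] at h
    refine h.trans ?_
    simp [Polynomial.map_mul, Polynomial.map_pow]
end

section
/- For positive integers m, n, let ω = exp(2πi/m). Let A be the mn-by-mn complex matrix partitioned into n² blocks A(i,j), 1 ≤ i,j ≤ n, where each block A(i,j) = circ(a_0(i,j), …, a_{m−1}(i,j)) is an m-by-m circulant matrix. For k = 0, …, m−1 let S_k be the n-by-n matrix whose (i,j) entry is s_k(i,j) = Σ_{ℓ=0}^{m−1} a_ℓ(i,j) ω^{kℓ}. Then A is block permutative — that is, there exist permutations ν_1 = id, ν_2, …, ν_n of {1, …, n} such that A(i,j) = A(1, ν_i(j)) for all 1 ≤ i,j ≤ n — if and only if the matrices S_0, S_1, …, S_{m−1} are permutatively equivalent, that is, there exist permutations μ_1 = id, μ_2, …, μ_n of {1, …, n} such that s_k(i,j)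 = s_k(1, μ_i(j)) for all 1 ≤ i,j ≤ n and all k = 0, …, m−1. -/
open Matrix BigOperators

/-- A function on `Fin m` is determined by its discrete Fourier transform with respect to a
primitive `m`-th root of unity. -/
theorem IsPrimitiveRoot.sum_mul_pow_injective {R : Type*} [CommRing R] [IsDomain R] {m : ℕ}
    {ω : R} (hω : IsPrimitiveRoot ω m) {f g : Fin m → R}
    (h : ∀ k : Fin m, ∑ ℓ : Fin m, f ℓ * ω ^ ((k : ℕ) * (ℓ : ℕ)) =
      ∑ ℓ : Fin m, g ℓ * ω ^ ((k : ℕ) * (ℓ : ℕ))) :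
    f = g := by
  have hinj : Function.Injective fun k : Fin m => ω ^ (k : ℕ) := fun i j hij =>
    Fin.ext (hω.pow_inj i.isLt j.isLt hij)
  refine sub_eq_zero.mp (eq_zero_of_forall_index_sum_mul_pow_eq_zero hinj fun k => ?_)
  simpa [sub_mul, ← pow_mul, mul_comm, sub_eq_zero, mul_sub] using h k

/-- With `ω = exp(2πi/m)`, `A` partitioned into circulant blocks and
`S_k(i,j) = Σ_ℓ a_ℓ(i,j) ω^{kℓ}`: `A` is block permutative (each block row is a
permutation of the first block row, via permutations `ν_i` with `ν_1 = id`) iff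
the matrices `S_0, …, S_{m-1}` are permutatively equivalent (the same tuple of row
permutations, with first permutation the identity, works for all of them). -/
theorem block_permutative_iff_Sk_permutatively_equivalent
    (m n : ℕ) (hm : 0 < m) [NeZero n]
    (ω : ℂ) (hω : ω = Complex.exp (2 * Real.pi * Complex.I / m))
    (a : Fin m → Fin n → Fin n → ℂ)
    (A : Matrix (Fin n × Fin m) (Fin n × Fin m) ℂ)
    (hA : ∀ (i j : Fin n) (p q : Fin m), A (i, p) (j, q) = a (q - p) i j)
    (S : Fin m → Matrix (Fin n) (Fin n) ℂ)
    (hS : ∀ (k : Fin m) (i j : Fin n),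
      S k i j = ∑ ℓ : Fin m, a ℓ i j * ω ^ ((k : ℕ) * (ℓ : ℕ))) :
    (∃ ν : Fin n → Equiv.Perm (Fin n), ν 0 = Equiv.refl (Fin n) ∧
        ∀ (i j : Fin n) (p q : Fin m), A (i, p) (j, q) = A (0, p) (ν i j, q)) ↔
      (∃ μ : Fin n → Equiv.Perm (Fin n), μ 0 = Equiv.refl (Fin n) ∧
        ∀ (k : Fin m) (i j : Fin n), S k i j = S k 0 (μ i j)) := by
  have : NeZero m := ⟨hm.ne'⟩
  have hroot : IsPrimitiveRoot ω m := hω ▸ Complex.isPrimitiveRoot_exp m hm.ne'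
  have hblock (i i' j j' : Fin n) :
      (∀ p q : Fin m, A (i, p) (j, q) = A (i', p) (j', q)) ↔
        ∀ k : Fin m, S k i j = S k i' j' := by
    simp only [hA, hS]
    constructor
    · intro h k
      have hcoeff (ℓ : Fin m) : a ℓ i j = a ℓ i' j' := by simpa using h 0 ℓ
      simp only [hcoeff]
    · intro h p q
      exact congrFun (hroot.sum_mul_pow_injective (f := fun ℓ => a ℓ i j)
        (g := fun ℓ => a ℓ i' j') h) (q - p)
  simp only [hblock]
  exact exists_congr fun μ => and_congr_right fun _ =>
    ⟨fun h k i j => h i j k, fun h i j k => h k i j⟩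
end

section
/- Let t be a nonnegative real number and let λ₁, …, λ_{n−1} be complex numbers with real parts less than or equal to zero such that the list (λ₁, …, λ_{n−1}) is closed under complex conjugation. Set λ₀ = 2t − λ₁ − ⋯ − λ_{n−1} and write f(x) = (x − λ₀)·∏_{j=1}^{n−1}(x − λ_j) = xⁿ − 2t·x^{n−1} + α₂·x^{n−2} + α₃·x^{n−3} + ⋯ + α_n (all the coefficients α_j are real). Then α₂ ≤ 0 implies α_j ≤ 0 for every j = 3, …, n. -/
open Polynomial BigOperators

/-- The coefficients of a polynomial, extended by zero to negative indices. -/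
noncomputable def intCoeff {R : Type*} [Semiring R] (P : R[X]) (k : ℤ) : R :=
  if 0 ≤ k then P.coeff k.toNat else 0

lemma intCoeff_natCast {R : Type*} [Semiring R] (P : R[X]) (k : ℕ) :
    intCoeff P k = P.coeff k := by
  simp [intCoeff]

lemma intCoeff_X_sub_C_mul {R : Type*} [CommRing R] (P : R[X]) (z : R) (k : ℤ) :
    intCoeff ((X - C z) * P) k = intCoeff P (k - 1) - z * intCoeff P k := by
  rcases lt_trichotomy k 0 with hk | rfl | hk
  · simp only [intCoeff, if_neg (not_le.2 hk), if_neg (show ¬ 0 ≤ k - 1 by omega), mul_zero,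
      sub_zero]
  · simp [intCoeff, sub_mul]
  · obtain ⟨m, rfl⟩ : ∃ m : ℕ, k = (m : ℤ) + 1 := ⟨(k - 1).toNat, by omega⟩
    have h1 : ((m : ℤ) + 1).toNat = m + 1 := by omega
    simp [intCoeff, h1, sub_mul, coeff_X_mul, show (0 : ℤ) ≤ m + 1 by omega]

/-- A nonnegative bi-infinite sequence all of whose Hurwitz matrix minors of order two are
nonnegative. -/
structure IsHurwitzSeq (b : ℤ → ℝ) : Prop where
  nonneg : ∀ k, 0 ≤ b k
  mul_le_mul : ∀ s u v w : ℤ, s ≤ u → s ≤ v → s + w = u + v → Even (u - s) →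
    b s * b w ≤ b u * b v

namespace IsHurwitzSeq

lemma single : IsHurwitzSeq (fun k => if k = 0 then 1 else 0) where
  nonneg k := by split_ifs <;> norm_num
  mul_le_mul s u v w hu hv hw _ := by
    by_cases h : s = 0 ∧ w = 0
    · obtain ⟨rfl, rfl⟩ := h
      have : u = 0 := by omega
      have : v = 0 := by omega
      simp [*]
    · have h0 : ((if s = 0 then 1 else 0) * (if w = 0 then 1 else 0) : ℝ) = 0 := by
        by_cases hs : s = 0
        · simp [show w ≠ 0 from fun hw' => h ⟨hs, hw'⟩]
        · simp [hs]
      rw [h0]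
      positivity

lemma linear_mul {b : ℤ → ℝ} (hb : IsHurwitzSeq b) {a : ℝ} (ha : 0 ≤ a) :
    IsHurwitzSeq (fun k => b (k - 1) + a * b k) where
  nonneg k := add_nonneg (hb.nonneg _) (mul_nonneg ha (hb.nonneg _))
  mul_le_mul s u v w hu hv hw he := by
    rcases eq_or_lt_of_le hv with rfl | hv'
    · obtain rfl : w = u := by omega
      exact (mul_comm _ _).le
    have h1 := hb.mul_le_mul (s - 1) (u - 1) (v - 1) (w - 1) (by omega) (by omega) (by omega)
      (by grind)
    have h2 := hb.mul_le_mul s u v w hu hv hw he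
    have h3 := hb.mul_le_mul (s - 1) (u - 1) v w (by omega) (by omega) (by omega) (by grind)
    have h4 := hb.mul_le_mul s u (v - 1) (w - 1) (by omega) (by omega) (by omega) (by grind)
    linarith [mul_le_mul_of_nonneg_left h2 (mul_nonneg ha ha),
      mul_le_mul_of_nonneg_left h3 ha, mul_le_mul_of_nonneg_left h4 ha]

lemma quadratic_mul {b : ℤ → ℝ} (hb : IsHurwitzSeq b) {p q : ℝ} (hp : 0 ≤ p) (hq : 0 ≤ q) :
    IsHurwitzSeq (fun k => b (k - 2) + p * b (k - 1) + q * b k) where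
  nonneg k := add_nonneg (add_nonneg (hb.nonneg _) (mul_nonneg hp (hb.nonneg _)))
    (mul_nonneg hq (hb.nonneg _))
  mul_le_mul s u v w hu hv hw he := by
    rcases eq_or_lt_of_le hv with rfl | hv'
    · obtain rfl : w = u := by omega
      exact (mul_comm _ _).le
    rcases eq_or_lt_of_le hu with rfl | hu'
    · obtain rfl : w = v := by omega
      exact le_rfl
    have h0 := hb.mul_le_mul (s - 2) (u - 2) (v - 2) (w - 2) (by omega) (by omega) (by omega)
      (by grind)
    have h1 := hb.mul_le_mul (s - 1) (u - 1) (v - 1) (w - 1) (by omega) (by omega) (by omega)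
      (by grind)
    have h2 := hb.mul_le_mul s u v w hu hv hw he
    have h3 := hb.mul_le_mul (s - 2) (u - 2) (v - 1) (w - 1) (by omega) (by omega) (by omega)
      (by grind)
    have h4 := hb.mul_le_mul (s - 1) (u - 1) (v - 2) (w - 2) (by omega) (by omega) (by omega)
      (by grind)
    have h5 := hb.mul_le_mul (s - 1) (u - 1) v w (by omega) (by omega) (by omega) (by grind)
    have h6 := hb.mul_le_mul s u (v - 1) (w - 1) (by omega) (by omega) (by omega) (by grind)
    have h7 : b (s - 2) * b w + b s * b (w - 2) ≤ b (u - 2) * b v + b u * b (v - 2) := by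
      by_cases h : s + 2 ≤ v
      · exact add_le_add
          (hb.mul_le_mul (s - 2) (u - 2) v w (by omega) (by omega) (by omega) (by grind))
          (hb.mul_le_mul s u (v - 2) (w - 2) (by omega) (by omega) (by omega) (by grind))
      · have hu2 : s + 2 ≤ u := by
          obtain ⟨r, hr⟩ := he
          omega
        rw [add_comm (b (u - 2) * b v)]
        exact add_le_add
          (hb.mul_le_mul (s - 2) u (v - 2) w (by omega) (by omega) (by omega) (by grind))
          (hb.mul_le_mul s (u - 2) v (w - 2) (by omega) (by omega) (by omega) (by grind))
    linarith [mul_le_mul_of_nonneg_left h1 (mul_nonneg hp hp),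
      mul_le_mul_of_nonneg_left h2 (mul_nonneg hq hq),
      mul_le_mul_of_nonneg_left h3 hp, mul_le_mul_of_nonneg_left h4 hp,
      mul_le_mul_of_nonneg_left h5 (mul_nonneg hp hq),
      mul_le_mul_of_nonneg_left h6 (mul_nonneg hp hq),
      mul_le_mul_of_nonneg_left h7 hq]

/-- If `b m = 1` is the leading term, a bound on the second ratio of consecutive terms propagates
to all the later ones. -/
lemma le_mul_of_le_mul {b : ℤ → ℝ} (hb : IsHurwitzSeq b) {m : ℤ} (hm : b m = 1) {c : ℝ}
    (hc : b (m - 1) ≤ c) (h2 : b (m - 2) ≤ c * b (m - 1)) {j : ℤ} (hj : 3 ≤ j) :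
    b (m - j) ≤ c * b (m - j + 1) := by
  have hc0 : 0 ≤ c := (hb.nonneg _).trans hc
  have hnn := hb.nonneg (m - j + 1)
  rcases Int.even_or_odd j with he | ho
  · rcases (hb.nonneg (m - 1)).eq_or_lt with h0 | hpos
    · have h2' : b (m - 2) = 0 := le_antisymm (by simpa [← h0] using h2) (hb.nonneg _)
      have h := hb.mul_le_mul (m - j) (m - 2) (m - j + 2) m (by omega) (by omega) (by omega)
        (by grind)
      rw [hm, h2'] at h
      nlinarith
    · have h := hb.mul_le_mul (m - j) (m - 2) (m - j + 1) (m - 1) (by omega) (by omega)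
        (by omega) (by grind)
      refine le_of_mul_le_mul_right ?_ hpos
      nlinarith [mul_le_mul_of_nonneg_right h2 hnn]
  · have h := hb.mul_le_mul (m - j) (m - 1) (m - j + 1) m (by omega) (by omega) (by omega)
      (by grind)
    rw [hm] at h
    nlinarith [mul_le_mul_of_nonneg_right hc hnn]

end IsHurwitzSeq

/-- The coefficients of a real polynomial with all roots in the closed left half-plane form a
Hurwitz sequence. -/
lemma exists_isHurwitzSeq_intCoeff (S : Multiset ℂ) (hre : ∀ z ∈ S, z.re ≤ 0)
    (hS : S.map (starRingEnd ℂ) = S) :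
    ∃ b : ℤ → ℝ, IsHurwitzSeq b ∧
      ∀ k, intCoeff (S.map (fun z => X - C z)).prod k = (b k : ℂ) := by
  induction S using Multiset.strongInductionOn with
  | ih S ih =>
  rcases S.empty_or_exists_mem with rfl | ⟨z, hz⟩
  · refine ⟨_, IsHurwitzSeq.single, fun k => ?_⟩
    simp only [intCoeff, Multiset.map_zero, Multiset.prod_zero, coeff_one]
    split_ifs <;> first | omega | simp
  obtain ⟨T, rfl⟩ := Multiset.exists_cons_of_mem hz
  by_cases hreal : starRingEnd ℂ z = z
  · have hT : T.map (starRingEnd ℂ) = T := by simpa [hreal] using hS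
    obtain ⟨b, hb, hbT⟩ := ih T (Multiset.lt_cons_self T z)
      (fun w hw => hre w (Multiset.mem_cons_of_mem hw)) hT
    refine ⟨_, hb.linear_mul (neg_nonneg.2 (hre z hz)), fun k => ?_⟩
    rw [Multiset.map_cons, Multiset.prod_cons, intCoeff_X_sub_C_mul, hbT, hbT]
    nth_rewrite 1 [← Complex.conj_eq_iff_re.1 hreal]
    push_cast
    ring
  · have hmem : starRingEnd ℂ z ∈ T := by
      have h : starRingEnd ℂ z ∈ z ::ₘ T := hS ▸ Multiset.mem_map_of_mem _ hz
      exact (Multiset.mem_cons.1 h).resolve_left hreal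
    obtain ⟨U, rfl⟩ := Multiset.exists_cons_of_mem hmem
    have hU : U.map (starRingEnd ℂ) = U := by
      rw [Multiset.map_cons, Multiset.map_cons, Complex.conj_conj, Multiset.cons_swap] at hS
      simpa using hS
    obtain ⟨b, hb, hbU⟩ := ih U
      ((Multiset.lt_cons_self U _).trans (Multiset.lt_cons_self _ z))
      (fun w hw => hre w (Multiset.mem_cons_of_mem (Multiset.mem_cons_of_mem hw))) hU
    refine ⟨_, hb.quadratic_mul (p := -(2 * z.re)) (by linarith [hre z hz])
      (Complex.normSq_nonneg z), fun k => ?_⟩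
    have hadd : z + starRingEnd ℂ z = 2 * z.re := by
      simpa using Complex.add_conj z
    simp only [Multiset.map_cons, Multiset.prod_cons, intCoeff_X_sub_C_mul, hbU]
    push_cast
    rw [← Complex.mul_conj, ← hadd, show k - 1 - 1 = k - 2 by ring]
    ring

/-- Laffey–Šmigoc: let `t ≥ 0` and `λ₁, …, λ_{n-1}` be complex
numbers with nonpositive real parts whose list is closed under complex
conjugation. With `λ₀ = 2t − λ₁ − ⋯ − λ_{n-1}` and
`f = (X − λ₀)·∏_j (X − λ_j) = Xⁿ − 2t X^{n−1} + α₂ X^{n−2} + ⋯ + α_n`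
(the coefficients `α_j` being real), `α₂ ≤ 0` implies `α_j ≤ 0` for
`j = 3, …, n`. Here `α_j` is the coefficient of `X^{n−j}` in `f`; "`α_j ≤ 0`"
is rendered as "`f.coeff (n − j)` is real and nonpositive". -/
theorem laffey_smigoc_coefficients
    (n : ℕ) (hn : 2 ≤ n)
    (t : ℝ) (ht : 0 ≤ t)
    (lam : Fin (n - 1) → ℂ)
    (hre : ∀ j, (lam j).re ≤ 0)
    (hclosed : (Finset.univ.val.map lam) =
      (Finset.univ.val.map (fun j => starRingEnd ℂ (lam j))))
    (lam₀ : ℂ) (hlam₀ : lam₀ = 2 * (t : ℂ) - ∑ j, lam j)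
    (f : Polynomial ℂ)
    (hf : f = (X - C lam₀) * ∏ j, (X - C (lam j)))
    (hα₂ : (f.coeff (n - 2)).re ≤ 0 ∧ (f.coeff (n - 2)).im = 0) :
    ∀ j : ℕ, 3 ≤ j → j ≤ n →
      (f.coeff (n - j)).re ≤ 0 ∧ (f.coeff (n - j)).im = 0 := by
  obtain ⟨b, hb, hbS⟩ := exists_isHurwitzSeq_intCoeff (Finset.univ.val.map lam)
    (by simpa using hre) (by rw [Multiset.map_map]; exact hclosed.symm)
  have hcard : (Finset.univ.val.map lam).card = n - 1 := by simp
  set m : ℤ := (n : ℤ) - 1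
  have hm : m = ((n - 1 : ℕ) : ℤ) := by omega
  have hf' : f = (X - C lam₀) * ((Finset.univ.val.map lam).map (fun z => X - C z)).prod := by
    rw [hf, Multiset.map_map]
    rfl
  have hb_top : b m = 1 := by
    have hmonic := monic_multiset_prod_of_monic (Finset.univ.val.map lam) (fun z => X - C z)
      (fun z _ => monic_X_sub_C z)
    have hdeg := natDegree_multiset_prod_X_sub_C_eq_card (Finset.univ.val.map lam)
    have h := hmonic.coeff_natDegree
    rw [hdeg, hcard, ← intCoeff_natCast, hbS, ← hm] at h
    exact_mod_cast h
  have hsum : ∑ j, lam j = -(b (m - 1) : ℂ) := by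
    have h := multiset_prod_X_sub_C_coeff_card_pred (Finset.univ.val.map lam)
      (by rw [hcard]; omega)
    rw [← intCoeff_natCast, hbS, hcard, show ((n - 1 - 1 : ℕ) : ℤ) = m - 1 by omega] at h
    rw [h, neg_neg]
    rfl
  have hlam : lam₀ = ((2 * t + b (m - 1) : ℝ) : ℂ) := by
    rw [hlam₀, hsum]
    push_cast
    ring
  have hcoeff : ∀ j : ℕ, j ≤ n →
      f.coeff (n - j) = ((b (m - j) - (2 * t + b (m - 1)) * b (m - j + 1) : ℝ) : ℂ) := by
    intro j hj
    rw [← intCoeff_natCast, hf', intCoeff_X_sub_C_mul, hbS, hbS, hlam,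
      show ((n - j : ℕ) : ℤ) - 1 = m - j by omega,
      show ((n - j : ℕ) : ℤ) = m - j + 1 by omega]
    push_cast
    ring
  have h2 : b (m - 2) ≤ (2 * t + b (m - 1)) * b (m - 1) := by
    have h := hα₂.1
    rw [hcoeff 2 hn, Complex.ofReal_re, show m - ((2 : ℕ) : ℤ) = m - 2 by norm_num,
      show m - 2 + 1 = m - 1 by ring] at h
    linarith
  intro j hj hjn
  rw [hcoeff j hjn, Complex.ofReal_re, Complex.ofReal_im]
  exact ⟨sub_nonpos.2 (hb.le_mul_of_le_mul hb_top (by linarith) h2 (by exact_mod_cast hj)), rfl⟩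
end
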